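/- arXiv:1905.13176 — 5 statements merged into one kernel-verified Lean document; each statement's English description precedes it below -/
import Mathlib

section
/- For every dimension n ≥ 1 there exists a constant C_n > 0, depending only on n, with the following property: if K ⊆ ℝⁿ is an open convex set and u : K → ℝ is a twice continuously differentiable function with u(x) ≥ 0 for all x ∈ K, whose Hessian matrix D²u(x) is positive definite at every point of K (strict convexity) and satisfies det D²u(x) ≥ 1 for every x ∈ K, then for every s > 0 the Lebesgue measure of the sublevel set satisfies |{x ∈ K : u(x) ≤ s}| ≤ C_n · s^{n/2}. -/
open MeasureTheory

/-- The Hessian matrix of second partial derivatives of `u` at `x`. -/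
noncomputable def hessianMatrix {n : ℕ} (u : EuclideanSpace ℝ (Fin n) → ℝ)
    (x : EuclideanSpace ℝ (Fin n)) : Matrix (Fin n) (Fin n) ℝ :=
  fun i j =>
    fderiv ℝ (fun y => fderiv ℝ u y (EuclideanSpace.single j 1)) x (EuclideanSpace.single i 1)

theorem EuclideanSpace.volume_setOf_abs_apply_sub_le {n : ℕ} (c : EuclideanSpace ℝ (Fin n))
    (r : ℝ) :
    volume {x : EuclideanSpace ℝ (Fin n) | ∀ i, |x i - c i| ≤ r} = ENNReal.ofReal (2 * r) ^ n := by
  rw [← (PiLp.volume_preserving_toLp (Fin n)).measure_preimage_emb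
    (MeasurableEquiv.toLp 2 (Fin n → ℝ)).measurableEmbedding]
  have : (WithLp.toLp 2) ⁻¹' {x : EuclideanSpace ℝ (Fin n) | ∀ i, |x i - c i| ≤ r} =
      Set.univ.pi fun i => Set.Icc (c i - r) (c i + r) := by
    ext x
    simp only [Set.mem_preimage, Set.mem_ofPred_eq, Set.mem_pi, Set.mem_univ, true_imp_iff,
      abs_le, Set.mem_Icc]
    refine forall_congr' fun i => ⟨fun h => ?_, fun h => ?_⟩ <;> constructor <;> linarith [h.1, h.2]
  rw [this, volume_pi_pi]
  simp [← two_mul]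

theorem LinearMap.exists_det_eq_coord_mul_det {n : ℕ}
    (T : EuclideanSpace ℝ (Fin n) →ₗ[ℝ] EuclideanSpace ℝ (Fin n))
    (x : EuclideanSpace ℝ (Fin n)) (i : Fin n) :
    ∃ T' : EuclideanSpace ℝ (Fin n) →ₗ[ℝ] EuclideanSpace ℝ (Fin n),
      T' (EuclideanSpace.single i 1) = T x ∧
      (∀ j ≠ i, T' (EuclideanSpace.single j 1) = T (EuclideanSpace.single j 1)) ∧
      T'.det = x i * T.det := by
  refine ⟨T ∘ₗ LinearMap.transvection (EuclideanSpace.proj i).toLinearMap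
    (x - EuclideanSpace.single i 1), ?_, fun j hj => ?_, ?_⟩
  · simp [LinearMap.transvection.apply]
  · simp [LinearMap.transvection.apply, hj.symm]
  · simp [LinearMap.det_comp, mul_comm]

theorem exists_linearMap_det_ne_zero_of_volume_ne_zero {n : ℕ}
    {S : Set (EuclideanSpace ℝ (Fin n))} (hS : volume S ≠ 0) :
    ∃ p ∈ S, ∃ T : EuclideanSpace ℝ (Fin n) →ₗ[ℝ] EuclideanSpace ℝ (Fin n),
      (∀ i, p + T (EuclideanSpace.single i 1) ∈ S) ∧ T.det ≠ 0 := by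
  obtain ⟨p, hp⟩ := nonempty_of_measure_ne_zero hS
  refine ⟨p, hp, ?_⟩
  have hspan : Submodule.span ℝ ((p + ·) ⁻¹' S) = ⊤ := by
    by_contra h
    apply hS
    rw [← measure_preimage_add volume p]
    exact measure_mono_null Submodule.subset_span (Measure.addHaar_submodule volume _ h)
  obtain ⟨f, hf, hfspan, -⟩ := Submodule.exists_fun_fin_finrank_span_eq ℝ ((p + ·) ⁻¹' S)
  have hn : Module.finrank ℝ (Submodule.span ℝ ((p + ·) ⁻¹' S)) = n := by
    rw [hspan, finrank_top, finrank_euclideanSpace_fin]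
  set b := (EuclideanSpace.basisFun (Fin n) ℝ).toBasis
  have hb (i : Fin n) : EuclideanSpace.single i 1 = b i := by simp [b]
  refine ⟨b.constr ℝ (f ∘ (finCongr hn).symm), fun i => ?_, ?_⟩
  · rw [hb, b.constr_basis]
    exact hf _
  · refine (LinearMap.isUnit_det _ ?_).ne_zero
    rw [LinearMap.isUnit_iff_range_eq_top, b.constr_range, (finCongr hn).symm.surjective.range_comp, hfspan, hspan]

theorem volume_le_of_forall_abs_det_le {n : ℕ} {S : Set (EuclideanSpace ℝ (Fin n))} {M : ℝ}
    (hM : ∀ p ∈ S, ∀ T : EuclideanSpace ℝ (Fin n) →ₗ[ℝ] EuclideanSpace ℝ (Fin n),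
      (∀ i, p + T (EuclideanSpace.single i 1) ∈ S) → |T.det| ≤ M) :
    volume S ≤ ENNReal.ofReal (4 ^ n * M) := by
  by_cases hS : volume S = 0
  · simp [hS]
  obtain ⟨p₀, hp₀, T₀, hT₀, hdet₀⟩ := exists_linearMap_det_ne_zero_of_volume_ne_zero hS
  let D : Set ℝ := {d | ∃ p ∈ S, ∃ T : EuclideanSpace ℝ (Fin n) →ₗ[ℝ] EuclideanSpace ℝ (Fin n),
      (∀ i, p + T (EuclideanSpace.single i 1) ∈ S) ∧ |T.det| = d}
  have hD : BddAbove D := ⟨M, by rintro _ ⟨p, hp, T, hT, rfl⟩; exact hM p hp T hT⟩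
  have hD₀ : |T₀.det| ∈ D := ⟨p₀, hp₀, T₀, hT₀, rfl⟩
  have hpos : 0 < sSup D := (abs_pos.2 hdet₀).trans_le (le_csSup hD hD₀)
  obtain ⟨_, ⟨p, hp, T, hT, rfl⟩, hlt⟩ := exists_lt_of_lt_csSup ⟨_, hD₀⟩ (half_lt_self hpos)
  have hdet : 0 < |T.det| := (half_pos hpos).trans hlt
  have hunit : IsUnit T :=
    (LinearMap.isUnit_iff_isUnit_det T).2 (isUnit_iff_ne_zero.2 (abs_pos.1 hdet))
  have hsub : (p + ·) ⁻¹' S ⊆ T '' {x | ∀ i, |x i - (0 : EuclideanSpace ℝ (Fin n)) i| ≤ 2} := by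
    intro y hy
    obtain ⟨x, rfl⟩ := LinearMap.range_eq_top.1 ((LinearMap.isUnit_iff_range_eq_top T).1 hunit) y
    refine ⟨x, fun i => ?_, rfl⟩
    obtain ⟨T', hi, hj, hT'⟩ := T.exists_det_eq_coord_mul_det x i
    have : |x i| * |T.det| ≤ sSup D := by
      refine le_csSup hD ⟨p, hp, T', fun j => ?_, by rw [hT', abs_mul]⟩
      rcases eq_or_ne j i with rfl | h
      · rwa [hi]
      · rw [hj j h]; exact hT j
    have : |x i| * |T.det| ≤ 2 * |T.det| := by linarith
    simpa using le_of_mul_le_mul_right this hdet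
  calc volume S = volume ((p + ·) ⁻¹' S) := (measure_preimage_add volume p S).symm
    _ ≤ _ := measure_mono hsub
    _ = ENNReal.ofReal |T.det| * ENNReal.ofReal (2 * 2) ^ n := by
      rw [Measure.addHaar_image_linearMap, EuclideanSpace.volume_setOf_abs_apply_sub_le]
    _ = ENNReal.ofReal (4 ^ n * |T.det|) := by
      rw [← ENNReal.ofReal_pow (by norm_num), ← ENNReal.ofReal_mul (abs_nonneg _), mul_comm]
      norm_num
    _ ≤ _ := by gcongr; exact hM p hp T hT

theorem differentiableAt_fderiv_of_contDiffOn_two {E : Type*} [NormedAddCommGroup E]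
    [NormedSpace ℝ E] {K : Set E} {u : E → ℝ} (hK : IsOpen K) (hu : ContDiffOn ℝ 2 u K)
    {x : E} (hx : x ∈ K) : DifferentiableAt ℝ (fderiv ℝ u) x :=
  ((hu.contDiffAt (hK.mem_nhds hx)).fderiv_right (m := 1) (by norm_num)).differentiableAt
    (by norm_num)

theorem hessianMatrix_apply {n : ℕ} {u : EuclideanSpace ℝ (Fin n) → ℝ}
    {x : EuclideanSpace ℝ (Fin n)} (h : DifferentiableAt ℝ (fderiv ℝ u) x) (i j : Fin n) :
    hessianMatrix u x i j = fderiv ℝ (fderiv ℝ u) x (EuclideanSpace.single i 1)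
      (EuclideanSpace.single j 1) := by
  rw [hessianMatrix, fderiv_clm_apply h (differentiableAt_const _)]
  simp

theorem fderiv_fderiv_apply_self_pos {n : ℕ} {u : EuclideanSpace ℝ (Fin n) → ℝ}
    {x : EuclideanSpace ℝ (Fin n)} (h : DifferentiableAt ℝ (fderiv ℝ u) x)
    (hpos : (hessianMatrix u x).PosDef) {w : EuclideanSpace ℝ (Fin n)} (hw : w ≠ 0) :
    0 < fderiv ℝ (fderiv ℝ u) x w w := by
  have hw' : w.ofLp ≠ 0 := fun h => hw (by ext i; simp [h])
  have key := hpos.dotProduct_mulVec_pos hw'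
  have hsum : w = ∑ i, w i • EuclideanSpace.single i (1 : ℝ) := by
    simpa using ((EuclideanSpace.basisFun (Fin n) ℝ).sum_repr w).symm
  convert! key using 1
  conv_lhs => rw [hsum]
  simp only [map_sum, map_smul, _root_.sum_apply, _root_.smul_apply,
    dotProduct, Matrix.mulVec, hessianMatrix_apply h, smul_eq_mul, Pi.star_apply, star_trivial,
    Finset.mul_sum]
  rw [Finset.sum_comm]
  exact Finset.sum_congr rfl fun i _ => Finset.sum_congr rfl fun j _ => by ring

theorem add_fderiv_sub_lt_of_hessianMatrix_posDef {n : ℕ} {K : Set (EuclideanSpace ℝ (Fin n))}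
    {u : EuclideanSpace ℝ (Fin n) → ℝ} (hK : IsOpen K) (hKc : Convex ℝ K)
    (hu : ContDiffOn ℝ 2 u K) (hpos : ∀ x ∈ K, (hessianMatrix u x).PosDef)
    {x y : EuclideanSpace ℝ (Fin n)} (hx : x ∈ K) (hy : y ∈ K) (hxy : x ≠ y) :
    u x + fderiv ℝ u x (y - x) < u y := by
  have hγ (t : ℝ) (ht : t ∈ Set.Icc 0 1) : x + t • (y - x) ∈ K :=
    hKc.add_smul_sub_mem hx hy ht
  have hγ' (t : ℝ) : HasDerivAt (fun t : ℝ => x + t • (y - x)) (y - x) t := by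
    simpa using ((hasDerivAt_id t).smul_const (y - x)).const_add x
  have h₁ (t : ℝ) (ht : t ∈ Set.Icc 0 1) : HasDerivAt (fun t : ℝ => u (x + t • (y - x)))
      (fderiv ℝ u (x + t • (y - x)) (y - x)) t := by
    have := ((hu.contDiffAt (hK.mem_nhds (hγ t ht))).differentiableAt (by norm_num)).hasFDerivAt
    exact this.comp_hasDerivAt t (hγ' t)
  have h₂ (t : ℝ) (ht : t ∈ Set.Icc 0 1) :
      HasDerivAt (fun t : ℝ => fderiv ℝ u (x + t • (y - x)) (y - x))
        (fderiv ℝ (fderiv ℝ u) (x + t • (y - x)) (y - x) (y - x)) t := by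
    have hd := (differentiableAt_fderiv_of_contDiffOn_two hK hu (hγ t ht)).hasFDerivAt
    have hc : HasDerivAt (fun t : ℝ => fderiv ℝ u (x + t • (y - x)))
        (fderiv ℝ (fderiv ℝ u) (x + t • (y - x)) (y - x)) t :=
      HasFDerivAt.comp_hasDerivAt (l := fderiv ℝ u) t hd (hγ' t)
    exact ((ContinuousLinearMap.apply ℝ ℝ (y - x)).hasFDerivAt).comp_hasDerivAt t hc
  obtain ⟨c, hc, hc'⟩ := exists_hasDerivAt_eq_slope (fun t : ℝ => u (x + t • (y - x)))
    (fun t => fderiv ℝ u (x + t • (y - x)) (y - x)) zero_lt_one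
    (fun t ht => (h₁ t ht).continuousAt.continuousWithinAt)
    (fun t ht => h₁ t (Set.Ioo_subset_Icc_self ht))
  have hsub : Set.Icc 0 c ⊆ Set.Icc 0 1 := Set.Icc_subset_Icc_right hc.2.le
  obtain ⟨d, hd, hd'⟩ := exists_hasDerivAt_eq_slope
    (fun t : ℝ => fderiv ℝ u (x + t • (y - x)) (y - x))
    (fun t => fderiv ℝ (fderiv ℝ u) (x + t • (y - x)) (y - x) (y - x)) hc.1
    (fun t ht => (h₂ t (hsub ht)).continuousAt.continuousWithinAt)
    (fun t ht => h₂ t (hsub (Set.Ioo_subset_Icc_self ht)))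
  have hdK := hγ d (hsub (Set.Ioo_subset_Icc_self hd))
  have hp := fderiv_fderiv_apply_self_pos (differentiableAt_fderiv_of_contDiffOn_two hK hu hdK)
    (hpos _ hdK) (sub_ne_zero.2 hxy.symm)
  rw [hd', sub_zero, div_pos_iff_of_pos_right hc.1] at hp
  simp only [one_smul, zero_smul, add_zero, add_sub_cancel, sub_zero, div_one] at hc' hp
  linarith

theorem convex_sublevel_of_hessianMatrix_posDef {n : ℕ} {K : Set (EuclideanSpace ℝ (Fin n))}
    {u : EuclideanSpace ℝ (Fin n) → ℝ} (hK : IsOpen K) (hKc : Convex ℝ K)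
    (hu : ContDiffOn ℝ 2 u K) (hpos : ∀ x ∈ K, (hessianMatrix u x).PosDef) (s : ℝ) :
    Convex ℝ {x ∈ K | u x ≤ s} := by
  have hle {x y : EuclideanSpace ℝ (Fin n)} (hx : x ∈ K) (hy : y ∈ K) :
      u x + fderiv ℝ u x (y - x) ≤ u y := by
    rcases eq_or_ne x y with rfl | h
    · simp
    · exact (add_fderiv_sub_lt_of_hessianMatrix_posDef hK hKc hu hpos hx hy h).le
  rintro x ⟨hx, hxs⟩ y ⟨hy, hys⟩ a b ha hb hab
  have hz := hKc hx hy ha hb hab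
  refine ⟨hz, ?_⟩
  set z := a • x + b • y with hz_def
  have hzero : a * fderiv ℝ u z (x - z) + b * fderiv ℝ u z (y - z) = 0 := by
    rw [← smul_eq_mul, ← smul_eq_mul, ← map_smul, ← map_smul, ← map_add]
    have : a • (x - z) + b • (y - z) = 0 := by
      rw [smul_sub, smul_sub, sub_add_sub_comm, ← add_smul, hab, one_smul, sub_self]
    rw [this, map_zero]
  calc u z = a * (u z + fderiv ℝ u z (x - z)) + b * (u z + fderiv ℝ u z (y - z)) := by
        linear_combination (-u z) * hab - hzero
    _ ≤ a * s + b * s := by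
      gcongr
      · exact (hle hz hx).trans hxs
      · exact (hle hz hy).trans hys
    _ = s := by rw [← add_mul, hab, one_mul]

theorem injOn_gradient_of_hessianMatrix_posDef {n : ℕ} {K : Set (EuclideanSpace ℝ (Fin n))}
    {u : EuclideanSpace ℝ (Fin n) → ℝ} (hK : IsOpen K) (hKc : Convex ℝ K)
    (hu : ContDiffOn ℝ 2 u K) (hpos : ∀ x ∈ K, (hessianMatrix u x).PosDef) :
    Set.InjOn (gradient u) K := by
  intro x hx y hy hxy
  by_contra hne
  have h₁ := add_fderiv_sub_lt_of_hessianMatrix_posDef hK hKc hu hpos hx hy hne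
  have h₂ := add_fderiv_sub_lt_of_hessianMatrix_posDef hK hKc hu hpos hy hx (Ne.symm hne)
  rw [← (InnerProductSpace.toDual ℝ _).symm.injective hxy, ← neg_sub y x, map_neg] at h₂
  linarith

theorem exists_hasFDerivAt_gradient_det_eq {n : ℕ} {u : EuclideanSpace ℝ (Fin n) → ℝ}
    {x : EuclideanSpace ℝ (Fin n)} (h : DifferentiableAt ℝ (fderiv ℝ u) x) :
    ∃ L : EuclideanSpace ℝ (Fin n) →L[ℝ] EuclideanSpace ℝ (Fin n),
      HasFDerivAt (gradient u) L x ∧ L.det = (hessianMatrix u x).det := by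
  let e := (InnerProductSpace.toDual ℝ (EuclideanSpace ℝ (Fin n))).symm.toContinuousLinearEquiv
  refine ⟨e.toContinuousLinearMap.comp (fderiv ℝ (fderiv ℝ u) x),
    e.toContinuousLinearMap.hasFDerivAt.comp x h.hasFDerivAt, ?_⟩
  rw [← Matrix.det_transpose, ContinuousLinearMap.det,
    ← LinearMap.det_toMatrix (EuclideanSpace.basisFun (Fin n) ℝ).toBasis]
  congr 1
  ext i j
  rw [Matrix.transpose_apply, hessianMatrix_apply h, LinearMap.toMatrix_apply]
  have (v : EuclideanSpace ℝ (Fin n)) : v i = inner ℝ v (EuclideanSpace.single i 1) := by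
    simp [EuclideanSpace.inner_single_right]
  simp only [OrthonormalBasis.coe_toBasis, EuclideanSpace.basisFun_apply,
    OrthonormalBasis.coe_toBasis_repr_apply, EuclideanSpace.basisFun_repr]
  rw [this]
  exact InnerProductSpace.toDual_symm_apply

theorem volume_le_volume_gradient_image {n : ℕ} {K A : Set (EuclideanSpace ℝ (Fin n))}
    {u : EuclideanSpace ℝ (Fin n) → ℝ} (hK : IsOpen K) (hKc : Convex ℝ K)
    (hu : ContDiffOn ℝ 2 u K) (hpos : ∀ x ∈ K, (hessianMatrix u x).PosDef)
    (hdet : ∀ x ∈ K, 1 ≤ (hessianMatrix u x).det) (hA : MeasurableSet A) (hAK : A ⊆ K) :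
    volume A ≤ volume (gradient u '' A) := by
  choose! L hL hLdet using fun x (hx : x ∈ A) => exists_hasFDerivAt_gradient_det_eq
    (differentiableAt_fderiv_of_contDiffOn_two hK hu (hAK hx))
  rw [← lintegral_abs_det_fderiv_eq_addHaar_image volume hA
    (fun x hx => (hL x hx).hasFDerivWithinAt)
    ((injOn_gradient_of_hessianMatrix_posDef hK hKc hu hpos).mono hAK), ← setLIntegral_one]
  refine setLIntegral_mono' hA fun x hx => ?_
  rw [hLdet x hx, ENNReal.one_le_ofReal]
  exact (hdet x (hAK hx)).trans (le_abs_self _)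

theorem Convex.add_linearMap_mem {n : ℕ} {S : Set (EuclideanSpace ℝ (Fin n))} (hS : Convex ℝ S)
    {p : EuclideanSpace ℝ (Fin n)} (hp : p ∈ S)
    {T : EuclideanSpace ℝ (Fin n) →ₗ[ℝ] EuclideanSpace ℝ (Fin n)}
    (hT : ∀ i, p + T (EuclideanSpace.single i 1) ∈ S) {x : EuclideanSpace ℝ (Fin n)}
    (hx : ∀ i, 0 ≤ x i) (hx1 : ∑ i, x i ≤ 1) : p + T x ∈ S := by
  have key := hS.sum_mem (t := Finset.univ) (w := fun o : Option (Fin n) => o.elim (1 - ∑ i, x i : ℝ) fun i => x i)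
    (z := fun o => o.elim p fun i => p + T (EuclideanSpace.single i 1))
    (by rintro (_ | i) -; exacts [sub_nonneg.2 hx1, hx i]) (by simp [Fintype.sum_option])
    (by rintro (_ | i) -; exacts [hp, hT i])
  convert! key using 1
  have hsum : x = ∑ i, x i • EuclideanSpace.single i (1 : ℝ) := by
    simpa using ((EuclideanSpace.basisFun (Fin n) ℝ).sum_repr x).symm
  simp only [Fintype.sum_option, Option.elim, smul_add, Finset.sum_add_distrib, sub_smul, one_smul,
    ← Finset.sum_smul]
  conv_lhs => rw [hsum]
  simp only [map_sum, map_smul]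
  abel

theorem abs_fderiv_apply_le_of_add_mem_sublevel {n : ℕ} {K : Set (EuclideanSpace ℝ (Fin n))}
    {u : EuclideanSpace ℝ (Fin n) → ℝ} (hK : IsOpen K) (hKc : Convex ℝ K)
    (hu : ContDiffOn ℝ 2 u K) (hnonneg : ∀ x ∈ K, 0 ≤ u x)
    (hpos : ∀ x ∈ K, (hessianMatrix u x).PosDef) {s : ℝ} {x v : EuclideanSpace ℝ (Fin n)}
    (hx : x ∈ K) (hadd : x + v ∈ {x ∈ K | u x ≤ s}) (hsub : x - v ∈ {x ∈ K | u x ≤ s}) :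
    |fderiv ℝ u x v| ≤ s := by
  have h0 := hnonneg x hx
  rcases eq_or_ne v 0 with rfl | hv
  · simpa using (hnonneg _ hadd.1).trans hadd.2
  have h₁ := add_fderiv_sub_lt_of_hessianMatrix_posDef hK hKc hu hpos hx hadd.1 (by simpa)
  have h₂ := add_fderiv_sub_lt_of_hessianMatrix_posDef hK hKc hu hpos hx hsub.1
    (by simpa [sub_eq_add_neg] using hv)
  rw [add_sub_cancel_left] at h₁
  rw [sub_sub_cancel_left, map_neg] at h₂
  rw [abs_le]
  constructor <;> linarith [hadd.2, hsub.2]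

theorem LinearMap.det_adjoint_euclideanSpace {n : ℕ}
    (T : EuclideanSpace ℝ (Fin n) →ₗ[ℝ] EuclideanSpace ℝ (Fin n)) :
    (LinearMap.adjoint T).det = T.det := by
  rw [← LinearMap.det_toMatrix (EuclideanSpace.basisFun (Fin n) ℝ).toBasis,
    LinearMap.toMatrix_adjoint, Matrix.det_conjTranspose, LinearMap.det_toMatrix, star_trivial]

theorem det_sq_le_of_simplex_subset_sublevel {n : ℕ} {K : Set (EuclideanSpace ℝ (Fin n))}
    {u : EuclideanSpace ℝ (Fin n) → ℝ} (hK : IsOpen K) (hKc : Convex ℝ K)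
    (hu : ContDiffOn ℝ 2 u K) (hnonneg : ∀ x ∈ K, 0 ≤ u x)
    (hpos : ∀ x ∈ K, (hessianMatrix u x).PosDef)
    (hdet : ∀ x ∈ K, 1 ≤ (hessianMatrix u x).det) {s : ℝ} (hs : 0 < s)
    {p : EuclideanSpace ℝ (Fin n)} (hp : p ∈ {x ∈ K | u x ≤ s})
    {T : EuclideanSpace ℝ (Fin n) →ₗ[ℝ] EuclideanSpace ℝ (Fin n)}
    (hT : ∀ i, p + T (EuclideanSpace.single i 1) ∈ {x ∈ K | u x ≤ s}) :
    T.det ^ 2 ≤ (2 * (2 * n + 1) ^ 2 * s) ^ n := by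
  rcases eq_or_ne T.det 0 with h0 | h0
  · rw [h0]
    rcases n with _ | n
    · simp
    · simp only [ne_eq, OfNat.ofNat_ne_zero, not_false_eq_true, zero_pow]
      positivity
  have hS := convex_sublevel_of_hessianMatrix_posDef hK hKc hu hpos s
  set δ : ℝ := 1 / (2 * n + 1) with hδ
  have hδ0 : 0 < δ := by positivity
  set c : EuclideanSpace ℝ (Fin n) := WithLp.toLp 2 fun _ => 3 / 2 * δ with hc
  set Q : Set (EuclideanSpace ℝ (Fin n)) := {x | ∀ i, |x i - c i| ≤ δ / 2} with hQ
  have hQmem {x : EuclideanSpace ℝ (Fin n)} (hx : x ∈ Q) (i : Fin n) : δ ≤ x i ∧ x i ≤ 2 * δ := by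
    have := abs_le.1 (hx i)
    simp only [hc] at this
    constructor <;> linarith
  have hsum {x : EuclideanSpace ℝ (Fin n)} (hx : x ∈ Q) : ∑ i, x i + δ ≤ 1 := by
    have : ∑ i, x i ≤ ∑ _i : Fin n, 2 * δ := Finset.sum_le_sum fun i _ => (hQmem hx i).2
    have h1 : (n : ℝ) * (2 * δ) + δ = 1 := by rw [hδ]; field_simp
    simp only [Finset.sum_const, Finset.card_univ, Fintype.card_fin, nsmul_eq_mul] at this
    linarith
  have hmem {x : EuclideanSpace ℝ (Fin n)} (hx : x ∈ Q) (i : Fin n) (t : ℝ) (ht : |t| ≤ δ) :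
      p + T x + t • T (EuclideanSpace.single i 1) ∈ {x ∈ K | u x ≤ s} := by
    rw [add_assoc, ← map_smul, ← map_add]
    have ht' := abs_le.1 ht
    refine hS.add_linearMap_mem hp hT (fun j => ?_) ?_
    · rcases eq_or_ne j i with rfl | h
      · simpa using by linarith [(hQmem hx j).1]
      · simpa [h] using by linarith [(hQmem hx j).1]
    · have : ∑ j, (t • EuclideanSpace.single i (1 : ℝ)) j = t := by simp
      simp only [PiLp.add_apply, Finset.sum_add_distrib, this]
      linarith [hsum hx]
  have hmem0 {x : EuclideanSpace ℝ (Fin n)} (hx : x ∈ Q) : p + T x ∈ K := by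
    refine (hS.add_linearMap_mem hp hT (fun j => ?_) ?_).1
    · linarith [(hQmem hx j).1]
    · linarith [hsum hx]
  set A := (fun x => p + T x) '' Q with hA
  have hAK : A ⊆ K := by rintro _ ⟨x, hx, rfl⟩; exact hmem0 hx
  have hQcompact : IsCompact Q := by
    convert! (EuclideanSpace.equiv (Fin n) ℝ).toHomeomorph.isClosedEmbedding.isCompact_preimage
      (isCompact_univ_pi fun i => isCompact_closedBall (c i) (δ / 2)) using 1
    ext x
    simp [hQ, Real.dist_eq]
  have hAmeas : MeasurableSet A :=
    (hQcompact.image (by have := T.continuous_of_finiteDimensional; fun_prop)).measurableSet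
  have hAvol : volume A = ENNReal.ofReal (|T.det| * δ ^ n) := by
    rw [hA, ← Set.image_image (p + ·) T, Set.image_add_left, measure_preimage_add,
      Measure.addHaar_image_linearMap, EuclideanSpace.volume_setOf_abs_apply_sub_le,
      mul_div_cancel₀ _ (two_ne_zero' ℝ), ENNReal.ofReal_mul (abs_nonneg _),
      ENNReal.ofReal_pow hδ0.le]
  have himage : gradient u '' A ⊆ LinearMap.adjoint T ⁻¹'
      {q | ∀ i, |q i - (0 : EuclideanSpace ℝ (Fin n)) i| ≤ s / δ} := by
    rintro _ ⟨_, ⟨x, hx, rfl⟩, rfl⟩ i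
    have hle : |fderiv ℝ u (p + T x) (δ • T (EuclideanSpace.single i 1))| ≤ s := by
      refine abs_fderiv_apply_le_of_add_mem_sublevel hK hKc hu hnonneg hpos (hmem0 hx)
        (hmem hx i δ (abs_of_pos hδ0).le) ?_
      simpa [sub_eq_add_neg] using hmem hx i (-δ) (by rw [abs_neg, abs_of_pos hδ0])
    have heq : (LinearMap.adjoint T (gradient u (p + T x))) i =
        fderiv ℝ u (p + T x) (T (EuclideanSpace.single i 1)) := by
      have (v : EuclideanSpace ℝ (Fin n)) : v i = inner ℝ v (EuclideanSpace.single i 1) := by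
        simp [EuclideanSpace.inner_single_right]
      rw [this, LinearMap.adjoint_inner_left]
      exact InnerProductSpace.toDual_symm_apply
    rw [map_smul, smul_eq_mul, abs_mul, abs_of_pos hδ0] at hle
    rw [heq, PiLp.zero_apply, sub_zero, le_div_iff₀' hδ0]
    exact hle
  have hvol : ENNReal.ofReal (|T.det| * δ ^ n) ≤
      ENNReal.ofReal (|T.det|⁻¹ * (2 * (s / δ)) ^ n) := by
    rw [← hAvol]
    refine (volume_le_volume_gradient_image hK hKc hu hpos hdet hAmeas hAK).trans
      ((measure_mono himage).trans_eq ?_)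
    have hadj := T.det_adjoint_euclideanSpace
    rw [Measure.addHaar_preimage_linearMap _ (by rwa [hadj]), hadj,
      EuclideanSpace.volume_setOf_abs_apply_sub_le, abs_inv, ← ENNReal.ofReal_pow (by positivity),
      ← ENNReal.ofReal_mul (by positivity)]
  have hreal := (ENNReal.ofReal_le_ofReal_iff (by positivity)).1 hvol
  have habs : 0 < |T.det| := abs_pos.2 h0
  rw [inv_mul_eq_div, le_div_iff₀ habs] at hreal
  have : T.det ^ 2 * δ ^ n ≤ (2 * (s / δ)) ^ n := by
    rw [← sq_abs]; linarith
  rw [← le_div_iff₀ (by positivity), ← div_pow] at this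
  convert! this using 2
  rw [hδ]
  field_simp

/-- Carbery's sublevel set estimate: if `u ≥ 0` is strictly convex on an open convex set `K`
with `det D²u ≥ 1`, then `|{x ∈ K : u(x) ≤ s}| ≤ C_n s^{n/2}`. -/
theorem carbery_sublevel (n : ℕ) (hn : 1 ≤ n) :
    ∃ C : ℝ, 0 < C ∧
      ∀ (K : Set (EuclideanSpace ℝ (Fin n))) (u : EuclideanSpace ℝ (Fin n) → ℝ),
        IsOpen K → Convex ℝ K → ContDiffOn ℝ 2 u K →
        (∀ x ∈ K, 0 ≤ u x) →
        (∀ x ∈ K, (hessianMatrix u x).PosDef) →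
        (∀ x ∈ K, 1 ≤ (hessianMatrix u x).det) →
        ∀ s : ℝ, 0 < s →
          volume {x ∈ K | u x ≤ s} ≤ ENNReal.ofReal (C * s ^ ((n : ℝ) / 2)) := by
  refine ⟨4 ^ n * (2 * (2 * n + 1) ^ 2) ^ ((n : ℝ) / 2), by positivity, ?_⟩
  intro K u hK hKc hu hnonneg hpos hdet s hs
  rw [mul_assoc, ← Real.mul_rpow (by positivity) hs.le]
  refine volume_le_of_forall_abs_det_le fun p hp T hT => ?_
  have h := det_sq_le_of_simplex_subset_sublevel hK hKc hu hnonneg hpos hdet hs hp hT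
  rw [Real.rpow_div_two_eq_sqrt _ (by positivity), Real.rpow_natCast]
  refine abs_le_of_sq_le_sq ?_ (by positivity)
  rwa [pow_right_comm, Real.sq_sqrt (by positivity)]
end

section
/- Let n ≥ 1, r > 0, and let u be a twice continuously differentiable real-valued function defined on an open neighborhood of the closed ball B̄(0,r) = {x ∈ ℝⁿ : ‖x‖ ≤ r} satisfying Δu(x) ≥ 1 for all x with ‖x‖ ≤ r. Then sup_{‖x‖ ≤ r} u(x) − inf_{‖x‖ ≤ r} u(x) ≥ r²/(2n). -/
/-- The Laplacian `Δu(x) = ∑ i, ∂²u/∂x_i²(x)`. -/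
noncomputable def laplacian {n : ℕ} (u : EuclideanSpace ℝ (Fin n) → ℝ)
    (x : EuclideanSpace ℝ (Fin n)) : ℝ :=
  ∑ i : Fin n,
    fderiv ℝ (fun y => fderiv ℝ u y (EuclideanSpace.single i 1)) x (EuclideanSpace.single i 1)

open Filter Topology in
/-- The second derivative of a function continuous at a local maximum is nonpositive there. -/
lemma IsLocalMax.deriv_deriv_nonpos {f : ℝ → ℝ} {a : ℝ} (hf : IsLocalMax f a)
    (hc : ContinuousAt f a) : deriv (deriv f) a ≤ 0 := by
  by_contra! h
  have hmin : IsLocalMin f a := isLocalMin_of_deriv_deriv_pos h hf.deriv_eq_zero hc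
  have hconst : f =ᶠ[𝓝 a] fun _ => f a := by
    filter_upwards [hf, hmin] with t h1 h2 using le_antisymm h1 h2
  have hzero := hconst.deriv.deriv_eq
  simp at hzero
  exact h.ne' hzero

open Filter Topology in
/-- At a local maximum of `u - c‖·‖²`, every pure second partial derivative of `u` is at most
`2c`. -/
lemma second_partial_le_of_isLocalMax_sub_norm_sq {n : ℕ} {u : EuclideanSpace ℝ (Fin n) → ℝ}
    {x : EuclideanSpace ℝ (Fin n)} {c : ℝ} (hu : ContDiffAt ℝ 2 u x)
    (hmax : IsLocalMax (fun y => u y - c * ‖y‖ ^ 2) x) (i : Fin n) :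
    fderiv ℝ (fun y => fderiv ℝ u y (EuclideanSpace.single i 1)) x
      (EuclideanSpace.single i 1) ≤ 2 * c := by
  set e : EuclideanSpace ℝ (Fin n) := EuclideanSpace.single i 1 with he
  have hline (t : ℝ) : HasDerivAt (fun t : ℝ => x + t • e) e t := by
    simpa using ((hasDerivAt_id t).smul_const e).const_add x
  have hcont : Tendsto (fun t : ℝ => x + t • e) (𝓝 0) (𝓝 x) := by
    simpa using (hline 0).continuousAt.tendsto
  have hnorm (t : ℝ) : ‖x + t • e‖ ^ 2 = ‖x‖ ^ 2 + 2 * t * inner ℝ x e + t ^ 2 := by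
    rw [norm_add_sq_real, inner_smul_right, norm_smul, mul_pow]
    simp [he]
    ring
  have hd : ∀ᶠ t : ℝ in 𝓝 0,
      HasDerivAt (fun t : ℝ => u (x + t • e) - c * ‖x + t • e‖ ^ 2)
        (fderiv ℝ u (x + t • e) e - c * (2 * inner ℝ x e + 2 * t)) t := by
    filter_upwards [hcont.eventually (hu.eventually (by simp))] with t ht
    simp only [hnorm]
    refine ((ht.differentiableAt (by simp)).hasFDerivAt.comp_hasDerivAt t (hline t)).sub
      (HasDerivAt.const_mul c ?_)
    have h1 := (((hasDerivAt_id t).const_mul 2).mul_const (inner ℝ x e)).const_add (‖x‖ ^ 2)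
    simpa using h1.fun_add (hasDerivAt_pow 2 t)
  have hpartial : DifferentiableAt ℝ (fun y => fderiv ℝ u y e) x :=
    ((hu.fderiv_right (m := 1) (by norm_num)).differentiableAt (by simp)).clm_apply
      (differentiableAt_const e)
  have hdd : HasDerivAt (fun t : ℝ => fderiv ℝ u (x + t • e) e - c * (2 * inner ℝ x e + 2 * t))
      (fderiv ℝ (fun y => fderiv ℝ u y e) x e - c * 2) 0 := by
    refine HasDerivAt.sub ?_ (HasDerivAt.const_mul c ?_)
    · have hx : HasFDerivAt (fun y => fderiv ℝ u y e) (fderiv ℝ (fun y => fderiv ℝ u y e) x)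
          (x + (0 : ℝ) • e) := by
        simpa using hpartial.hasFDerivAt
      exact hx.comp_hasDerivAt 0 (hline 0)
    · simpa using ((hasDerivAt_id (0 : ℝ)).const_mul 2).const_add (2 * inner ℝ x e)
  have hderiv : deriv (fun t : ℝ => u (x + t • e) - c * ‖x + t • e‖ ^ 2) =ᶠ[𝓝 0]
      fun t => fderiv ℝ u (x + t • e) e - c * (2 * inner ℝ x e + 2 * t) := by
    filter_upwards [hd] with t ht using ht.deriv
  have hlocal : IsLocalMax (fun t : ℝ => u (x + t • e) - c * ‖x + t • e‖ ^ 2) 0 := by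
    filter_upwards [hcont.eventually hmax] with t ht
    simpa using ht
  have hle := hlocal.deriv_deriv_nonpos hd.self_of_nhds.continuousAt
  rw [hderiv.deriv_eq, hdd.deriv] at hle
  linarith

/-- If `Δu ≥ 1` on the closed ball of radius `r`, then the oscillation of `u` on that ball is
at least `r²/(2n)`. -/
theorem oscillation_of_laplacian_ge_one (n : ℕ) (hn : 1 ≤ n) (r : ℝ) (hr : 0 < r)
    (U : Set (EuclideanSpace ℝ (Fin n))) (hU : IsOpen U)
    (hBU : Metric.closedBall (0 : EuclideanSpace ℝ (Fin n)) r ⊆ U)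
    (u : EuclideanSpace ℝ (Fin n) → ℝ) (hu : ContDiffOn ℝ 2 u U)
    (hlap : ∀ x ∈ Metric.closedBall (0 : EuclideanSpace ℝ (Fin n)) r, 1 ≤ laplacian u x) :
    r ^ 2 / (2 * n) ≤
      sSup (u '' Metric.closedBall (0 : EuclideanSpace ℝ (Fin n)) r) -
        sInf (u '' Metric.closedBall (0 : EuclideanSpace ℝ (Fin n)) r) := by
  have hn' : (0 : ℝ) < n := by exact_mod_cast hn
  have hcont : ContinuousOn u (Metric.closedBall 0 r) := hu.continuousOn.mono hBU
  have hcompact := isCompact_closedBall (0 : EuclideanSpace ℝ (Fin n)) r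
  have hbdd := hcompact.image_of_continuousOn hcont
  have hzero : (0 : EuclideanSpace ℝ (Fin n)) ∈ Metric.closedBall 0 r :=
    Metric.mem_closedBall_self hr.le
  have key : ∀ c : ℝ, c < 1 / (2 * n) → c * r ^ 2 ≤
      sSup (u '' Metric.closedBall (0 : EuclideanSpace ℝ (Fin n)) r) -
        sInf (u '' Metric.closedBall (0 : EuclideanSpace ℝ (Fin n)) r) := by
    intro c hc
    rw [lt_div_iff₀ (by positivity)] at hc
    obtain ⟨x, hx, hxmax⟩ := hcompact.exists_isMaxOn ⟨0, hzero⟩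
      (f := fun y => u y - c * ‖y‖ ^ 2) (by fun_prop)
    have hxr : ‖x‖ = r := by
      refine (mem_closedBall_zero_iff.mp hx).antisymm (not_lt.mp fun hlt => ?_)
      have hlocal : IsLocalMax (fun y => u y - c * ‖y‖ ^ 2) x :=
        hxmax.isLocalMax (Metric.closedBall_mem_nhds_of_mem (mem_ball_zero_iff.mpr hlt))
      have hsum : laplacian u x ≤ ∑ _i : Fin n, 2 * c := Finset.sum_le_sum fun i _ =>
        second_partial_le_of_isLocalMax_sub_norm_sq
          (hu.contDiffAt (hU.mem_nhds (hBU hx))) hlocal i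
      rw [Finset.sum_const, Finset.card_univ, Fintype.card_fin, nsmul_eq_mul] at hsum
      linarith [hlap x hx]
    have h0 : u 0 - c * ‖(0 : EuclideanSpace ℝ (Fin n))‖ ^ 2 ≤ u x - c * ‖x‖ ^ 2 := hxmax hzero
    rw [hxr, norm_zero] at h0
    linarith [le_csSup hbdd.bddAbove (Set.mem_image_of_mem u hx),
      csInf_le hbdd.bddBelow (Set.mem_image_of_mem u hzero)]
  have hr2 : 0 < r ^ 2 := by positivity
  rw [div_eq_inv_mul, ← one_div, ← le_div_iff₀ hr2]
  exact le_of_forall_lt_imp_le_of_dense fun c hc => (le_div_iff₀ hr2).mpr (key c hc)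
end

section
/- For every dimension n ≥ 1 there exists a constant c_n > 0, depending only on n, with the following property: if u : [0,1]ⁿ → ℝ is continuous on [0,1]ⁿ, twice continuously differentiable on the open cube (0,1)ⁿ, and satisfies Δu(x) ≥ 1 for all x ∈ (0,1)ⁿ, then |{x ∈ [0,1]ⁿ : |u(x)| ≥ c_n}| · sup_{x ∈ [0,1]ⁿ} |u(x)| ≥ c_n. -/
open MeasureTheory

/-- The closed unit cube `[0,1]ⁿ`. -/
def unitCube (n : ℕ) : Set (EuclideanSpace ℝ (Fin n)) := {x | ∀ i, x i ∈ Set.Icc (0 : ℝ) 1}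

/-- The open unit cube `(0,1)ⁿ`. -/
def openUnitCube (n : ℕ) : Set (EuclideanSpace ℝ (Fin n)) := {x | ∀ i, x i ∈ Set.Ioo (0 : ℝ) 1}

lemma isOpen_openUnitCube (n : ℕ) : IsOpen (openUnitCube n) := by
  simp only [openUnitCube, Set.ofPred_forall]
  exact isOpen_iInter_of_finite fun i => isOpen_Ioo.preimage (by fun_prop)

lemma openUnitCube_subset_unitCube (n : ℕ) : openUnitCube n ⊆ unitCube n :=
  fun _ hx i => Set.Ioo_subset_Icc_self (hx i)

lemma isCompact_unitCube (n : ℕ) : IsCompact (unitCube n) := by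
  have h := (EuclideanSpace.equiv (Fin n) ℝ).toHomeomorph.isCompact_preimage.2
    (isCompact_univ_pi fun _ : Fin n => isCompact_Icc (a := (0 : ℝ)) (b := 1))
  convert h using 1
  ext x
  simp only [unitCube, Set.mem_ofPred_eq, Set.mem_preimage, Set.mem_pi, Set.mem_univ, forall_const]
  rfl

/-- A function continuous on an open set `Ω` times a continuous function supported in `Ω` is
continuous. -/
lemma ContinuousOn.continuous_mul_of_tsupport_subset {X : Type*} [TopologicalSpace X]
    {Ω : Set X} {w φ : X → ℝ} (hΩ : IsOpen Ω) (hw : ContinuousOn w Ω) (hφ : Continuous φ)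
    (hsub : tsupport φ ⊆ Ω) : Continuous fun x => w x * φ x := by
  refine continuous_of_tsupport fun x hx => ?_
  exact (hw.continuousAt (hΩ.mem_nhds (hsub (tsupport_mul_subset_right hx)))).mul hφ.continuousAt

lemma ContinuousOn.integrable_mul_of_tsupport_subset {X : Type*} [TopologicalSpace X]
    [MeasurableSpace X] [OpensMeasurableSpace X] {μ : Measure X} [IsFiniteMeasureOnCompacts μ]
    {Ω : Set X} {w φ : X → ℝ} (hΩ : IsOpen Ω) (hw : ContinuousOn w Ω) (hφ : Continuous φ)
    (hc : HasCompactSupport φ) (hsub : tsupport φ ⊆ Ω) :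
    Integrable (fun x => w x * φ x) μ :=
  (hw.continuous_mul_of_tsupport_subset hΩ hφ hsub).integrable_of_hasCompactSupport hc.mul_left

/-- Integration by parts on an open set `Ω` against a test function supported in `Ω`. -/
lemma ContDiffOn.integral_mul_fderiv_eq_neg {E : Type*} [NormedAddCommGroup E] [NormedSpace ℝ E]
    [FiniteDimensional ℝ E] [MeasurableSpace E] [BorelSpace E] {μ : Measure E} [μ.IsAddHaarMeasure]
    {Ω : Set E} {w φ : E → ℝ} (hΩ : IsOpen Ω) (hw : ContDiffOn ℝ 1 w Ω)
    (hφ : ContDiff ℝ 1 φ) (hc : HasCompactSupport φ) (hsub : tsupport φ ⊆ Ω) (v : E) :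
    ∫ x, w x * fderiv ℝ φ x v ∂μ = - ∫ x, fderiv ℝ w x v * φ x ∂μ := by
  refine integral_mul_fderiv_eq_neg_fderiv_mul_of_integrable ?_ ?_ ?_ ?_ ?_
  · exact ((hw.continuousOn_fderiv_of_isOpen hΩ le_rfl).clm_apply
      continuousOn_const).integrable_mul_of_tsupport_subset hΩ hφ.continuous hc hsub
  · exact hw.continuousOn.integrable_mul_of_tsupport_subset hΩ
      ((hφ.continuous_fderiv one_ne_zero).clm_apply continuous_const) (hc.fderiv_apply ℝ v)
      ((tsupport_fderiv_apply_subset ℝ v).trans hsub)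
  · exact hw.continuousOn.integrable_mul_of_tsupport_subset hΩ hφ.continuous hc hsub
  · exact fun x hx => (hw.differentiableOn one_ne_zero).differentiableAt (hΩ.mem_nhds (hsub hx))
  · exact fun x _ => hφ.differentiable one_ne_zero x

lemma ContDiffOn.fderiv_apply_of_isOpen {E : Type*} [NormedAddCommGroup E] [NormedSpace ℝ E]
    {Ω : Set E} {u : E → ℝ} (hΩ : IsOpen Ω) (hu : ContDiffOn ℝ 2 u Ω) (v : E) :
    ContDiffOn ℝ 1 (fun y => fderiv ℝ u y v) Ω :=
  (hu.fderiv_of_isOpen hΩ (by norm_num)).clm_apply contDiffOn_const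

section Laplacian

variable {n : ℕ} {Ω : Set (EuclideanSpace ℝ (Fin n))} {u φ : EuclideanSpace ℝ (Fin n) → ℝ}

lemma ContDiffOn.continuousOn_laplacian (hΩ : IsOpen Ω) (hu : ContDiffOn ℝ 2 u Ω) :
    ContinuousOn (laplacian u) Ω :=
  continuousOn_finsetSum _ fun _ _ =>
    ((hu.fderiv_apply_of_isOpen hΩ _).continuousOn_fderiv_of_isOpen hΩ le_rfl).clm_apply
      continuousOn_const

lemma ContDiff.continuous_laplacian (hφ : ContDiff ℝ 2 φ) : Continuous (laplacian φ) :=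
  continuousOn_univ.1 (hφ.contDiffOn.continuousOn_laplacian isOpen_univ)

lemma tsupport_laplacian_subset : tsupport (laplacian φ) ⊆ tsupport φ := by
  refine closure_minimal (fun x hx => ?_) (isClosed_tsupport φ)
  obtain ⟨i, -, hi⟩ := Finset.exists_ne_zero_of_sum_ne_zero (Function.mem_support.1 hx)
  exact tsupport_fderiv_apply_subset ℝ _ (tsupport_fderiv_apply_subset ℝ _ (subset_tsupport _ hi))

lemma HasCompactSupport.laplacian (hc : HasCompactSupport φ) : HasCompactSupport (laplacian φ) :=
  IsCompact.of_isClosed_subset hc (isClosed_tsupport _) tsupport_laplacian_subset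

/-- Green's second identity against a test function. -/
lemma ContDiffOn.integral_mul_laplacian_eq (hΩ : IsOpen Ω) (hu : ContDiffOn ℝ 2 u Ω)
    (hφ : ContDiff ℝ 2 φ) (hc : HasCompactSupport φ) (hsub : tsupport φ ⊆ Ω) :
    ∫ x, u x * laplacian φ x = ∫ x, laplacian u x * φ x := by
  have hd (v) : ContDiff ℝ 1 (fun y => fderiv ℝ φ y v) :=
    contDiffOn_univ.1 (hφ.contDiffOn.fderiv_apply_of_isOpen isOpen_univ v)
  have hdsub (v) : tsupport (fun y => fderiv ℝ φ y v) ⊆ Ω :=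
    (tsupport_fderiv_apply_subset ℝ v).trans hsub
  simp only [laplacian, Finset.mul_sum, Finset.sum_mul]
  rw [integral_finsetSum, integral_finsetSum]
  · refine Finset.sum_congr rfl fun i _ => ?_
    set v := EuclideanSpace.single i (1 : ℝ)
    rw [(hu.of_le one_le_two).integral_mul_fderiv_eq_neg hΩ (hd v) (hc.fderiv_apply ℝ v) (hdsub v),
      (hu.fderiv_apply_of_isOpen hΩ v).integral_mul_fderiv_eq_neg hΩ (hφ.of_le one_le_two) hc hsub,
      neg_neg]
  · exact fun i _ => (((hu.fderiv_apply_of_isOpen hΩ _).continuousOn_fderiv_of_isOpen hΩ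
      le_rfl).clm_apply continuousOn_const).integrable_mul_of_tsupport_subset hΩ
      hφ.continuous hc hsub
  · exact fun i _ => hu.continuousOn.integrable_mul_of_tsupport_subset hΩ
      (((hd _).continuous_fderiv one_ne_zero).clm_apply continuous_const)
      ((hc.fderiv_apply ℝ _).fderiv_apply ℝ _)
      ((tsupport_fderiv_apply_subset ℝ _).trans (hdsub _))

end Laplacian

/-- Flatness estimate: there is `c_n > 0` such that every `u : [0,1]ⁿ → ℝ` with `Δu ≥ 1`
satisfies `|{x : |u(x)| ≥ c_n}| ⬝ ‖u‖_∞ ≥ c_n`. -/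
theorem flatness_estimate (n : ℕ) (hn : 1 ≤ n) :
    ∃ c : ℝ, 0 < c ∧
      ∀ u : EuclideanSpace ℝ (Fin n) → ℝ,
        ContinuousOn u (unitCube n) → ContDiffOn ℝ 2 u (openUnitCube n) →
        (∀ x ∈ openUnitCube n, 1 ≤ laplacian u x) →
        ENNReal.ofReal c ≤
          volume {x ∈ unitCube n | c ≤ |u x|} *
            ENNReal.ofReal (sSup ((fun x => |u x|) '' unitCube n)) := by
  have hΩ := isOpen_openUnitCube n
  have hK := isCompact_unitCube n
  set p : EuclideanSpace ℝ (Fin n) := WithLp.toLp 2 fun _ => 1 / 2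
  have hp : p ∈ openUnitCube n := fun i => by simp only [p]; norm_num
  obtain ⟨φ, hsub, hc, hφ, hrange, hφp⟩ := exists_contDiff_tsupport_subset (n := 2) (hΩ.mem_nhds hp)
  have hφ0 (x) : 0 ≤ φ x := (hrange ⟨x, rfl⟩).1
  have ha : 0 < ∫ x, φ x :=
    hφ.continuous.integral_pos_of_hasCompactSupport_nonneg_nonzero hc hφ0 (x := p) (by simp [hφp])
  set a := ∫ x, φ x
  obtain ⟨M₀, hM₀⟩ := hc.laplacian.exists_bound_of_continuous hφ.continuous_laplacian
  set M := max M₀ 1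
  have hM1 : 1 ≤ M := le_max_right _ _
  have hM (x) : |laplacian φ x| ≤ M := (hM₀ x).trans (le_max_left _ _)
  set V := volume.real (unitCube n)
  have hV : 0 ≤ V := measureReal_nonneg
  set c := a / (2 * M * (V + 1)) with hc_def
  have hc0 : 0 < c := by positivity
  have hc_mul : 2 * M * c * (V + 1) = a := by rw [hc_def]; field_simp
  refine ⟨c, hc0, fun u huc hu hlap => ?_⟩
  set A := {x ∈ unitCube n | c ≤ |u x|}
  set S := sSup ((fun x => |u x|) '' unitCube n)
  have hS {x} (hx : x ∈ unitCube n) : |u x| ≤ S :=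
    le_csSup (hK.bddAbove_image huc.abs) (Set.mem_image_of_mem _ hx)
  have hA : MeasurableSet A :=
    (huc.abs.preimage_isClosed_of_isClosed hK.isClosed isClosed_Ici).measurableSet
  have hAK : A ⊆ unitCube n := fun x hx => hx.1
  have hAfin : volume A ≠ ⊤ := measure_ne_top_of_subset hAK hK.measure_ne_top
  have hS0 : 0 ≤ S := (abs_nonneg _).trans (hS (openUnitCube_subset_unitCube n hp))
  have hlower : a ≤ ∫ x, u x * laplacian φ x := by
    rw [hu.integral_mul_laplacian_eq hΩ hφ hc hsub]
    refine integral_mono (hφ.continuous.integrable_of_hasCompactSupport hc)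
      ((hu.continuousOn_laplacian hΩ).integrable_mul_of_tsupport_subset hΩ hφ.continuous hc hsub)
      fun x => ?_
    by_cases hx : x ∈ openUnitCube n
    · exact le_mul_of_one_le_left (hφ0 x) (hlap x hx)
    · simp [image_eq_zero_of_notMem_tsupport fun h => hx (hsub h)]
  have hupper : ∫ x, u x * laplacian φ x ≤ M * c * V + M * S * volume.real A := by
    have hiK : Integrable ((unitCube n).indicator fun _ => M * c) :=
      (integrable_indicator_iff hK.measurableSet).2 (integrableOn_const hK.measure_ne_top)
    have hiA : Integrable (A.indicator fun _ => M * S) :=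
      (integrable_indicator_iff hA).2 (integrableOn_const hAfin)
    have hint : ∫ x, ((unitCube n).indicator (fun _ => M * c) x + A.indicator (fun _ => M * S) x)
        = M * c * V + M * S * volume.real A := by
      rw [integral_add hiK hiA, integral_indicator_const _ hK.measurableSet,
        integral_indicator_const _ hA, smul_eq_mul, smul_eq_mul]
      ring
    rw [← hint]
    refine integral_mono (hu.continuousOn.integrable_mul_of_tsupport_subset hΩ
      hφ.continuous_laplacian hc.laplacian (tsupport_laplacian_subset.trans hsub)) (hiK.add hiA)
      fun x => ?_
    have hbound : u x * laplacian φ x ≤ M * |u x| := by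
      calc u x * laplacian φ x ≤ |u x| * |laplacian φ x| := by
            rw [← abs_mul]; exact le_abs_self _
        _ ≤ |u x| * M := by gcongr; exact hM x
        _ = M * |u x| := mul_comm _ _
    by_cases hx : x ∈ unitCube n
    · by_cases hxA : x ∈ A
      · have h : M * |u x| ≤ M * S := by gcongr; exact hS hx
        have : 0 ≤ M * c := by positivity
        simp only [Set.indicator_of_mem hx, Set.indicator_of_mem hxA]
        linarith
      · have h : M * |u x| ≤ M * c := by
          gcongr
          exact (not_le.1 fun h => hxA ⟨hx, h⟩).le
        simp only [Set.indicator_of_mem hx, Set.indicator_of_notMem hxA]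
        linarith
    · have h : laplacian φ x = 0 := image_eq_zero_of_notMem_tsupport fun h =>
        hx (openUnitCube_subset_unitCube n (hsub (tsupport_laplacian_subset h)))
      simp [Set.indicator_of_notMem hx, Set.indicator_of_notMem fun h => hx (hAK h), h]
  have hmain : c ≤ volume.real A * S := by
    have h1 : 0 ≤ M * c * V := by positivity
    refine le_of_mul_le_mul_left ?_ (zero_lt_one.trans_le hM1)
    nlinarith
  calc ENNReal.ofReal c ≤ ENNReal.ofReal (volume.real A * S) := ENNReal.ofReal_le_ofReal hmain
    _ = volume A * ENNReal.ofReal S := by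
      rw [ENNReal.ofReal_mul measureReal_nonneg, ofReal_measureReal hAfin]
end

section
/- Let n ≥ 1, ε > 0, r > 0, y ∈ ℝⁿ, and let u be a twice continuously differentiable real-valued function defined on an open neighborhood of the closed ball B̄(y,r) = {x ∈ ℝⁿ : ‖x − y‖ ≤ r} satisfying Δu(x) ≥ 1 for all x ∈ B̄(y,r). If |u(x)| ≤ ε for every x ∈ B̄(y,r), then r ≤ 2·√(n·ε). In particular, a set of the form {x : |u(x)| ≤ ε} cannot contain a closed ball of radius strictly larger than 2√(nε). -/
theorem IsLocalMax.deriv_deriv_nonpos_s10 {g : ℝ → ℝ} {t : ℝ} (hg : IsLocalMax g t)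
    (hc : ContinuousAt g t) : deriv (deriv g) t ≤ 0 := by
  by_contra! h
  have hmin : IsLocalMin g t := isLocalMin_of_deriv_deriv_pos h hg.deriv_eq_zero hc
  have hconst : g =ᶠ[nhds t] fun _ => g t := by
    filter_upwards [hg, hmin] with s h₁ h₂ using le_antisymm h₁ h₂
  rw [hconst.deriv.deriv_eq] at h
  simp at h

/-- At a local maximum of `u - a‖· - y‖²`, the second derivative of `u` along a unit vector is
at most `2a`. -/
theorem fderiv_fderiv_le_of_isLocalMax_sub_norm_sq {E : Type*} [NormedAddCommGroup E]
    [InnerProductSpace ℝ E] {u : E → ℝ} {x y e : E} {a : ℝ} (hu : ContDiffAt ℝ 2 u x)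
    (he : ‖e‖ = 1) (hmax : IsLocalMax (fun z => u z - a * ‖z - y‖ ^ 2) x) :
    fderiv ℝ (fun z => fderiv ℝ u z e) x e ≤ 2 * a := by
  have hline (t : ℝ) : HasDerivAt (fun s : ℝ => x + s • e) e t := by
    simpa using ((hasDerivAt_id t).smul_const e).const_add x
  have htend : Filter.Tendsto (fun s : ℝ => x + s • e) (nhds 0) (nhds x) := by
    simpa [ContinuousAt] using (hline 0).continuousAt
  have hquad (t : ℝ) : HasDerivAt (fun s : ℝ => a * ‖x + s • e - y‖ ^ 2)
      (2 * a * inner ℝ (x - y) e + 2 * a * t) t := by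
    have hexp : (fun s : ℝ => a * ‖x + s • e - y‖ ^ 2) =
        fun s => a * (‖x - y‖ ^ 2 + 2 * (s * inner ℝ (x - y) e) + s ^ 2) := by
      funext s
      rw [add_sub_right_comm, norm_add_sq_real, inner_smul_right, norm_smul, he, mul_one,
        Real.norm_eq_abs, sq_abs]
    rw [hexp]
    refine ((((((hasDerivAt_id t).mul_const (inner ℝ (x - y) e)).const_mul 2).const_add
      (‖x - y‖ ^ 2)).add (hasDerivAt_pow 2 t)).const_mul a).congr_deriv ?_
    norm_num
    ring
  have hdiff : ∀ᶠ z in nhds x, DifferentiableAt ℝ u z :=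
    (hu.eventually (by simp)).mono fun z hz => hz.differentiableAt (by simp)
  have hderiv : ∀ᶠ t in nhds (0 : ℝ),
      HasDerivAt (fun s : ℝ => u (x + s • e) - a * ‖x + s • e - y‖ ^ 2)
        (fderiv ℝ u (x + t • e) e - (2 * a * inner ℝ (x - y) e + 2 * a * t)) t := by
    filter_upwards [htend.eventually hdiff] with t ht
    exact (ht.hasFDerivAt.comp_hasDerivAt t (hline t)).sub (hquad t)
  have hfd : DifferentiableAt ℝ (fun z => fderiv ℝ u z e) x :=
    ((hu.fderiv_right (m := 1) (by norm_num)).differentiableAt (by simp)).clm_apply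
      (differentiableAt_const e)
  have hsecond : HasDerivAt
      (fun t : ℝ => fderiv ℝ u (x + t • e) e - (2 * a * inner ℝ (x - y) e + 2 * a * t))
      (fderiv ℝ (fun z => fderiv ℝ u z e) x e - 2 * a) 0 := by
    have hx : HasFDerivAt (fun z => fderiv ℝ u z e) (fderiv ℝ (fun z => fderiv ℝ u z e) x)
        (x + (0 : ℝ) • e) := by
      simpa using hfd.hasFDerivAt
    have h₂ := ((hasDerivAt_id (0 : ℝ)).const_mul (2 * a)).const_add (2 * a * inner ℝ (x - y) e)
    rw [mul_one] at h₂
    exact (hx.comp_hasDerivAt 0 (hline 0)).sub h₂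
  have hloc : IsLocalMax (fun s : ℝ => u (x + s • e) - a * ‖x + s • e - y‖ ^ 2) 0 := by
    filter_upwards [htend.eventually hmax] with s hs
    simpa using hs
  have hle := hloc.deriv_deriv_nonpos_s10 hderiv.self_of_nhds.continuousAt
  have heq : deriv (fun s : ℝ => u (x + s • e) - a * ‖x + s • e - y‖ ^ 2) =ᶠ[nhds 0]
      fun t => fderiv ℝ u (x + t • e) e - (2 * a * inner ℝ (x - y) e + 2 * a * t) :=
    hderiv.mono fun t ht => ht.deriv
  rw [heq.deriv_eq, hsecond.deriv] at hle
  linarith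

/-- If `Δu ≥ 1` on a closed ball of radius `r` and `|u| ≤ ε` there, then `r ≤ 2√(nε)`:
a set where `|u| ≤ ε` cannot contain a ball of radius larger than `2√(nε)`. -/
theorem ball_radius_bound (n : ℕ) (hn : 1 ≤ n) (ε : ℝ) (hε : 0 < ε) (r : ℝ) (hr : 0 < r)
    (y : EuclideanSpace ℝ (Fin n)) (U : Set (EuclideanSpace ℝ (Fin n))) (hU : IsOpen U)
    (hBU : Metric.closedBall y r ⊆ U)
    (u : EuclideanSpace ℝ (Fin n) → ℝ) (hu : ContDiffOn ℝ 2 u U)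
    (hlap : ∀ x ∈ Metric.closedBall y r, 1 ≤ laplacian u x)
    (hsmall : ∀ x ∈ Metric.closedBall y r, |u x| ≤ ε) :
    r ≤ 2 * Real.sqrt (n * ε) := by
  by_contra! hlt
  have hn' : (0 : ℝ) < n := by exact_mod_cast hn
  have hr2 : 4 * (n * ε) < r ^ 2 := by
    have hsq := Real.sq_sqrt (by positivity : (0 : ℝ) ≤ n * ε)
    nlinarith [Real.sqrt_nonneg (n * ε)]
  obtain ⟨a, ha₁, ha₂⟩ : ∃ a : ℝ, 2 * ε / r ^ 2 < a ∧ a < 1 / (2 * n) := by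
    apply exists_between
    rw [div_lt_div_iff₀ (by positivity) (by positivity)]
    linarith
  rw [div_lt_iff₀ (by positivity)] at ha₁
  rw [lt_div_iff₀ (by positivity)] at ha₂
  have hy : y ∈ Metric.closedBall y r := Metric.mem_closedBall_self hr.le
  have hcont : ContinuousOn (fun z => u z - a * ‖z - y‖ ^ 2) (Metric.closedBall y r) :=
    (hu.continuousOn.mono hBU).sub (by fun_prop)
  obtain ⟨x, hx, hxmax⟩ := (isCompact_closedBall y r).exists_isMaxOn ⟨y, hy⟩ hcont
  have hxball : x ∈ Metric.ball y r := by
    by_contra hxb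
    have hxr : ‖x - y‖ = r := by
      rw [← dist_eq_norm]
      exact le_antisymm hx (not_lt.mp hxb)
    have hle : u y - a * ‖y - y‖ ^ 2 ≤ u x - a * ‖x - y‖ ^ 2 := hxmax hy
    rw [hxr, sub_self, norm_zero] at hle
    have h₁ := (abs_le.mp (hsmall y hy)).1
    have h₂ := (abs_le.mp (hsmall x hx)).2
    linarith
  have hloc : IsLocalMax (fun z => u z - a * ‖z - y‖ ^ 2) x :=
    hxmax.isLocalMax (Filter.mem_of_superset (Metric.isOpen_ball.mem_nhds hxball)
      Metric.ball_subset_closedBall)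
  have hsum : laplacian u x ≤ ∑ _i : Fin n, 2 * a :=
    Finset.sum_le_sum fun i _ => fderiv_fderiv_le_of_isLocalMax_sub_norm_sq
      (hu.contDiffAt (hU.mem_nhds (hBU hx))) (by simp) hloc
  rw [Finset.sum_const, Finset.card_univ, Fintype.card_fin, nsmul_eq_mul] at hsum
  linarith [hlap x hx]
end

section
/- Let D ⊆ ℝ² be a bounded open set. Then the 2-dimensional Lebesgue measure of D satisfies |D| ≤ (H¹(∂D))², where ∂D is the topological boundary (frontier) of D and H¹ denotes 1-dimensional Hausdorff measure (the inequality is interpreted in the extended reals, so it is trivially true when H¹(∂D) = ∞). -/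
open MeasureTheory

/-- Every line meeting a bounded set meets its frontier. -/
theorem Bornology.IsBounded.exists_add_smul_mem_frontier {E : Type*} [NormedAddCommGroup E]
    [NormedSpace ℝ E] {D : Set E} (hD : Bornology.IsBounded D) {x v : E} (hx : x ∈ D)
    (hv : v ≠ 0) : ∃ t : ℝ, x + t • v ∈ frontier D := by
  have hline : Continuous fun t : ℝ => x + t • v := by fun_prop
  have hout : ∃ t : ℝ, x + t • v ∉ D := by
    obtain ⟨R, hR⟩ := hD.exists_norm_le
    by_contra! h
    have hv' : 0 < ‖v‖ := norm_pos_iff.mpr hv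
    have h1 : ‖((R + ‖x‖ + 1) / ‖v‖) • v‖ = R + ‖x‖ + 1 := by
      have : 0 ≤ R := (norm_nonneg x).trans (hR x hx)
      rw [norm_smul, Real.norm_of_nonneg (by positivity), div_mul_cancel₀ _ hv'.ne']
    have h2 := hR _ (h ((R + ‖x‖ + 1) / ‖v‖))
    have h3 := norm_sub_le (x + ((R + ‖x‖ + 1) / ‖v‖) • v) x
    rw [add_sub_cancel_left, h1] at h3
    linarith
  obtain ⟨t, ht⟩ := hout
  obtain ⟨s, hs⟩ := (nonempty_frontier_iff (s := (fun t : ℝ => x + t • v) ⁻¹' D)).mpr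
    ⟨⟨0, by simpa using hx⟩, (Set.ne_univ_iff_exists_notMem _).mpr ⟨t, ht⟩⟩
  exact ⟨s, hline.frontier_preimage_subset D hs⟩

/-- The coordinate projections of a set of the plane have length at most its `H¹`-measure. -/
theorem EuclideanSpace.volume_image_apply_le {ι : Type*} [Fintype ι] (i : ι)
    (S : Set (EuclideanSpace ℝ ι)) :
    volume ((fun x : EuclideanSpace ℝ ι => x i) '' S) ≤ μH[1] S := by
  have hlip : LipschitzWith 1 fun x : EuclideanSpace ℝ ι => x i :=
    LipschitzWith.of_dist_le_mul fun x y => by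
      simpa [dist_eq_norm] using PiLp.norm_apply_le (x - y) i
  rw [← hausdorffMeasure_real]
  simpa using hlip.hausdorffMeasure_image_le zero_le_one S

/-- The volume of a set is at most the product of the lengths of its coordinate projections. -/
theorem EuclideanSpace.volume_le_prod_volume_image_apply {ι : Type*} [Fintype ι]
    (S : Set (EuclideanSpace ℝ ι)) :
    volume S ≤ ∏ i, volume ((fun x : EuclideanSpace ℝ ι => x i) '' S) := by
  rw [← volume_pi_pi, ← (EuclideanSpace.volume_preserving_symm_measurableEquiv_toLp
    ι).measure_preimage_equiv]
  exact measure_mono fun x hx i _ => ⟨x, hx, rfl⟩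

/-- For a bounded open planar set, the area is at most the square of the `H¹`-measure of
the boundary (in the extended reals). -/
theorem area_le_boundary_length_sq (D : Set (EuclideanSpace ℝ (Fin 2)))
    (hD : IsOpen D) (hDb : Bornology.IsBounded D) :
    volume D ≤ (μH[1] (frontier D)) ^ 2 := by
  have hproj (i j : Fin 2) (hij : j ≠ i) :
      volume ((fun x : EuclideanSpace ℝ (Fin 2) => x i) '' D) ≤ μH[1] (frontier D) := by
    refine (measure_mono ?_).trans (EuclideanSpace.volume_image_apply_le i _)
    rintro _ ⟨x, hx, rfl⟩
    obtain ⟨t, ht⟩ := hDb.exists_add_smul_mem_frontier hx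
      (v := EuclideanSpace.single j (1 : ℝ)) (by simp)
    exact ⟨_, ht, by simp [hij.symm]⟩
  refine (EuclideanSpace.volume_le_prod_volume_image_apply D).trans ?_
  rw [Fin.prod_univ_two, sq]
  exact mul_le_mul' (hproj 0 1 (by simp)) (hproj 1 0 (by simp))
end
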